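/- Let q be a prime power, m, n positive integers with n ≤ m, g_1, …, g_n ∈ F_{q^m} linearly independent over F_q, and k, d ≥ 1 with k + d < n. Let f(x) = x^{q^{k+d}} − a_1 x^{q^{k+d−1}} + a_2 x^{q^{k+d−2}} + ⋯ + (−1)^d a_d x^{q^k} + (terms of q-degree < k) be a monic q-linearized polynomial over F_{q^m} of q-degree k+d, and σ_f = (f(g_1), …, f(g_n)). Then d_R(σ_f, G) = n − (k+d) if and only if there exist k+d F_q-linearly independent elements β_1, …, β_{k+d} of ⟨g_1, …, g_n⟩ such that for all 1 ≤ i ≤ d, a_i = det(R_{k+d−i}(β_1, …, β_{k+d})) / det(M_{k+d}(β_1, …, β_{k+d})). -/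

import Mathlib

def gabidulinCode (q : ℕ) {F : Type} [Field F] {n : ℕ} (g : Fin n → F) (k : ℕ) :
    Set (Fin n → F) :=
  {c | ∃ v : Fin k → F, c = fun j => ∑ i : Fin k, v i * g j ^ q ^ (i : ℕ)}

noncomputable def rankDistTo (Fq : Type) [Field Fq] {F : Type} [Field F] [Algebra Fq F]
    {n : ℕ} (u : Fin n → F) (G : Set (Fin n → F)) : ℕ :=
  sInf {r : ℕ | ∃ c ∈ G, r = Module.finrank Fq (Submodule.span Fq (Set.range (u - c)))}

/-- The square Moore matrix `M_N(β_1, …, β_N)`, with `(i, j)` entry `β_j ^ (q ^ i)`. -/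
def mooreMatrix (q : ℕ) {F : Type} [Field F] {N : ℕ} (β : Fin N → F) :
    Matrix (Fin N) (Fin N) F :=
  Matrix.of fun i j => β j ^ q ^ (i : ℕ)

/-- The matrix `R_r(β_1, …, β_N)`: the `(N+1) × N` Moore matrix `M_{N+1}(β_1, …, β_N)`
with the row of exponent `q ^ r` deleted. -/
def mooreMatrixDelRow (q r : ℕ) {F : Type} [Field F] {N : ℕ} (β : Fin N → F) :
    Matrix (Fin N) (Fin N) F :=
  Matrix.of fun i j => β j ^ q ^ (if (i : ℕ) < r then (i : ℕ) else (i : ℕ) + 1)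

section RankDistance

variable {Fq F : Type} [Field Fq] [Field F] [Algebra Fq F]

theorem finrank_span_range_comp_add {n : ℕ} {g : Fin n → F} (hg : LinearIndependent Fq g)
    (L : F →ₗ[Fq] F) :
    Module.finrank Fq (Submodule.span Fq (Set.range (L ∘ g))) +
      Module.finrank Fq (LinearMap.ker (L.domRestrict (Submodule.span Fq (Set.range g)))) = n := by
  have : FiniteDimensional Fq (Submodule.span Fq (Set.range g)) :=
    FiniteDimensional.span_of_finite Fq (Set.finite_range g)
  rw [Set.range_comp, ← Submodule.map_span, ← LinearMap.range_domRestrict,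
    LinearMap.finrank_range_add_finrank_ker, finrank_span_eq_card hg, Fintype.card_fin]

theorem le_finrank_submodule_iff {N : ℕ} (W : Submodule Fq F) [FiniteDimensional Fq W] :
    N ≤ Module.finrank Fq W ↔ ∃ β : Fin N → F, LinearIndependent Fq β ∧ ∀ i, β i ∈ W := by
  constructor
  · intro h
    obtain ⟨b, hb⟩ := exists_linearIndependent_of_le_finrank h
    exact ⟨fun j => b j, hb.map' W.subtype (Submodule.ker_subtype _), fun j => (b j).2⟩
  · rintro ⟨β, hβ, hW⟩
    have hb : LinearIndependent Fq fun j => (⟨β j, hW j⟩ : W) :=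
      LinearIndependent.of_comp W.subtype hβ
    simpa using hb.fintype_card_le_finrank

theorem le_finrank_ker_domRestrict_iff {N : ℕ} (L : F →ₗ[Fq] F) (V : Submodule Fq F)
    [FiniteDimensional Fq V] :
    N ≤ Module.finrank Fq (LinearMap.ker (L.domRestrict V)) ↔
      ∃ β : Fin N → F, LinearIndependent Fq β ∧ (∀ i, β i ∈ V) ∧ ∀ i, L (β i) = 0 := by
  rw [← Submodule.finrank_map_subtype_eq V, LinearMap.ker_domRestrict,
    Submodule.map_comap_subtype, le_finrank_submodule_iff]
  simp only [Submodule.mem_inf, LinearMap.mem_ker, forall_and]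

/-- The distance to a nonempty code equals a lower bound iff some codeword attains it. -/
theorem rankDistTo_eq_iff {n : ℕ} {u : Fin n → F} {G : Set (Fin n → F)} {r : ℕ}
    (hG : G.Nonempty)
    (hr : ∀ c ∈ G, r ≤ Module.finrank Fq (Submodule.span Fq (Set.range (u - c)))) :
    rankDistTo Fq u G = r ↔
      ∃ c ∈ G, Module.finrank Fq (Submodule.span Fq (Set.range (u - c))) = r := by
  have hne : {r : ℕ | ∃ c ∈ G,
      r = Module.finrank Fq (Submodule.span Fq (Set.range (u - c)))}.Nonempty :=
    let ⟨c, hc⟩ := hG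
    ⟨_, c, hc, rfl⟩
  constructor
  · rintro rfl
    obtain ⟨c, hc, h⟩ := Nat.sInf_mem hne
    exact ⟨c, hc, h.symm⟩
  · rintro ⟨c, hc, h⟩
    refine le_antisymm (Nat.sInf_le ⟨c, hc, h.symm⟩) (le_csInf hne ?_)
    rintro _ ⟨c', hc', rfl⟩
    exact hr c' hc'

end RankDistance

open Finset in
/-- The `F_q`-linear map `x ↦ ∑_{i < N} w_i x^{q^i}`. -/
noncomputable def linearizedMap (Fq : Type) [Field Fq] [Fintype Fq] {F : Type} [Field F]
    [Algebra Fq F] (w : ℕ → F) (N : ℕ) : F →ₗ[Fq] F :=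
  ∑ i ∈ range N, w i • ((FiniteField.frobeniusAlgHom Fq F) ^ i).toLinearMap

section Linearized

open Finset

variable {Fq F : Type} [Field Fq] [Fintype Fq] [Field F] [Algebra Fq F]

theorem linearizedMap_apply (w : ℕ → F) (N : ℕ) (x : F) :
    linearizedMap Fq w N x = ∑ i ∈ range N, w i * x ^ Fintype.card Fq ^ i := by
  simp [linearizedMap, LinearMap.sum_apply, FiniteField.coe_frobeniusAlgHom, AlgHom.coe_pow,
    pow_iterate]

/-- A linearized polynomial of `q`-degree less than `N` that vanishes at `N` linearly independent
elements is zero. -/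
theorem eq_zero_of_linearizedMap_eq_zero {N : ℕ} {β : Fin N → F} (hβ : LinearIndependent Fq β)
    {w : ℕ → F} (hw : ∀ j, linearizedMap Fq w N (β j) = 0) {i : ℕ} (hi : i < N) : w i = 0 := by
  classical
  set q := Fintype.card Fq with hq
  have hq1 : 1 < q := Fintype.one_lt_card
  let P : Polynomial F := ∑ i ∈ range N, Polynomial.monomial (q ^ i) (w i)
  have heval (x : F) : P.eval x = linearizedMap Fq w N x := by
    simp [P, linearizedMap_apply, Polynomial.eval_finsetSum, hq]
  have hinj : Function.Injective fun v : Fin N → Fq => ∑ j, v j • β j :=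
    hβ.fintypeLinearCombination_injective
  have hdeg : P.natDegree < q ^ N := by
    have hN : 0 < N := by omega
    refine lt_of_le_of_lt (Polynomial.natDegree_sum_le_of_forall_le (n := q ^ (N - 1)) _ _ ?_)
      (Nat.pow_lt_pow_right hq1 (by omega))
    intro j hj
    refine (Polynomial.natDegree_monomial_le _).trans (Nat.pow_le_pow_right (by omega) ?_)
    have := mem_range.1 hj
    omega
  have hP : P = 0 := by
    refine Polynomial.eq_zero_of_natDegree_lt_card_of_eval_eq_zero P hinj (fun v => ?_) ?_
    · simp [heval, map_sum, map_smul, hw]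
    · simpa using hdeg
  have hcoeff := congrArg (fun p => Polynomial.coeff p (q ^ i)) hP
  simpa [P, Polynomial.finsetSum_coeff, Polynomial.coeff_monomial,
    Nat.pow_right_inj hq1, hi] using hcoeff

theorem det_mooreMatrix_ne_zero {N : ℕ} {β : Fin N → F} (hβ : LinearIndependent Fq β) :
    (mooreMatrix (Fintype.card Fq) β).det ≠ 0 := by
  intro h
  obtain ⟨v, hv0, hv⟩ := Matrix.exists_vecMul_eq_zero_iff.2 h
  refine hv0 (funext fun i => ?_)
  have key := eq_zero_of_linearizedMap_eq_zero hβ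
    (w := fun i => if h : i < N then v ⟨i, h⟩ else 0) (fun j => ?_) i.2
  · simpa using key
  · have := congrFun hv j
    rw [linearizedMap_apply, ← Fin.sum_univ_eq_sum_range
      (fun i => (if h : i < N then v ⟨i, h⟩ else 0) * β j ^ Fintype.card Fq ^ i)]
    simpa [Matrix.vecMul, dotProduct, mooreMatrix] using this

theorem mooreMatrixDelRow_self {q N : ℕ} (β : Fin N → F) :
    mooreMatrixDelRow q N β = mooreMatrix q β := by
  ext i j
  simp [mooreMatrixDelRow, mooreMatrix]

/-- The coefficient vector of the maximal minors of the Moore matrix annihilates its columns. -/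
theorem linearizedMap_det_mooreMatrixDelRow {N : ℕ} (β : Fin N → F) (l : Fin N) :
    linearizedMap Fq (fun i => (-1) ^ (i + N) * (mooreMatrixDelRow (Fintype.card Fq) i β).det)
      (N + 1) (β l) = 0 := by
  set q := Fintype.card Fq
  let A : Matrix (Fin (N + 1)) (Fin (N + 1)) F :=
    Matrix.of fun i j => (Fin.snoc β (β l) : Fin (N + 1) → F) j ^ q ^ (i : ℕ)
  have hA : A.det = 0 :=
    Matrix.det_zero_of_column_eq (i := l.castSucc) (j := Fin.last N) (Fin.castSucc_lt_last l).ne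
      (fun i => by simp [A])
  rw [Matrix.det_succ_column A (Fin.last N)] at hA
  rw [linearizedMap_apply, ← Fin.sum_univ_eq_sum_range
    (fun i => (-1) ^ (i + N) * (mooreMatrixDelRow q i β).det * β l ^ q ^ i), ← hA]
  refine Finset.sum_congr rfl fun i _ => ?_
  have hsub : A.submatrix i.succAbove (Fin.last N).succAbove = mooreMatrixDelRow q i β := by
    ext r s
    simp only [A, mooreMatrixDelRow, Matrix.submatrix_apply, Matrix.of_apply, Fin.succAbove_last,
      Fin.snoc_castSucc, Fin.succAbove, Fin.lt_def, Fin.val_castSucc]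
    split_ifs <;> simp
  rw [hsub]
  simp [A]
  ring

/-- The unique monic linearized polynomial of `q`-degree `N` vanishing at `β_1, …, β_N` has
coefficients given by quotients of Moore determinants. -/
theorem linearizedMap_eq_zero_iff {N : ℕ} {β : Fin N → F} (hβ : LinearIndependent Fq β)
    {w : ℕ → F} (hw : w N = 1) :
    (∀ l, linearizedMap Fq w (N + 1) (β l) = 0) ↔
      ∀ i < N, w i = (-1) ^ (i + N) * ((mooreMatrixDelRow (Fintype.card Fq) i β).det /
        (mooreMatrix (Fintype.card Fq) β).det) := by
  set q := Fintype.card Fq with hq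
  have hD := det_mooreMatrix_ne_zero hβ
  rw [← hq] at hD
  set D := (mooreMatrix q β).det
  let u : ℕ → F := fun i => (-1) ^ (i + N) * ((mooreMatrixDelRow q i β).det / D)
  have huN : u N = 1 := by
    simp only [u, mooreMatrixDelRow_self]
    rw [div_self hD, ← two_mul, pow_mul]
    simp
  have hu (l : Fin N) : linearizedMap Fq u (N + 1) (β l) = 0 := by
    have h := linearizedMap_det_mooreMatrixDelRow (Fq := Fq) β l
    rw [linearizedMap_apply] at h ⊢
    rw [← zero_div D, ← h, Finset.sum_div]
    refine Finset.sum_congr rfl fun i _ => ?_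
    simp only [u]
    ring
  constructor
  · intro h i hi
    have key := eq_zero_of_linearizedMap_eq_zero hβ (w := fun i => w i - u i) (fun j => ?_) hi
    · exact sub_eq_zero.1 key
    · have h1 := h j
      have h2 := hu j
      rw [linearizedMap_apply, sum_range_succ, hw] at h1
      rw [linearizedMap_apply, sum_range_succ, huN] at h2
      rw [linearizedMap_apply]
      simp only [sub_mul, Finset.sum_sub_distrib]
      linear_combination h1 - h2
  · intro h l
    rw [← hu l, linearizedMap_apply, linearizedMap_apply]
    refine Finset.sum_congr rfl fun i hi => ?_
    rcases (Nat.lt_succ_iff.1 (mem_range.1 hi)).lt_or_eq with hi | rfl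
    · rw [h i hi]
    · rw [hw, huN]

theorem finrank_ker_linearizedMap_domRestrict_le {N : ℕ} {w : ℕ → F} (hw : w N ≠ 0)
    (V : Submodule Fq F) [FiniteDimensional Fq V] :
    Module.finrank Fq (LinearMap.ker ((linearizedMap Fq w (N + 1)).domRestrict V)) ≤ N := by
  by_contra! h
  obtain ⟨β, hβ, -, h0⟩ := (le_finrank_ker_domRestrict_iff _ V).1 (Nat.succ_le_of_lt h)
  exact hw (eq_zero_of_linearizedMap_eq_zero hβ h0 (Nat.lt_succ_self N))

/-- The coefficients of `x^{q^{k+d}} + ∑_{1 ≤ i ≤ d} (-1)^i a_i x^{q^{k+d-i}} + ∑_{i<k} c_i x^{q^i}`. -/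
def monicCoeff (k d : ℕ) (a : ℕ → F) (c : Fin k → F) (i : ℕ) : F :=
  if h : i < k then c ⟨i, h⟩ else if i = k + d then 1 else (-1) ^ (k + d - i) * a (k + d - i)

theorem linearizedMap_monicCoeff (k d : ℕ) (a : ℕ → F) (c : Fin k → F) (x : F) :
    linearizedMap Fq (monicCoeff k d a c) (k + d + 1) x =
      x ^ Fintype.card Fq ^ (k + d) +
        (∑ i ∈ Icc 1 d, (-1 : F) ^ i * a i * x ^ Fintype.card Fq ^ (k + d - i)) +
        ∑ i : Fin k, c i * x ^ Fintype.card Fq ^ (i : ℕ) := by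
  set q := Fintype.card Fq
  have h1 : ∑ i ∈ range k, monicCoeff k d a c i * x ^ q ^ i =
      ∑ i : Fin k, c i * x ^ q ^ (i : ℕ) := by
    rw [← Fin.sum_univ_eq_sum_range (fun i => monicCoeff k d a c i * x ^ q ^ i)]
    simp [monicCoeff]
  have h2 : ∑ i ∈ range d, monicCoeff k d a c (k + i) * x ^ q ^ (k + i) =
      ∑ i ∈ Icc 1 d, (-1 : F) ^ i * a i * x ^ q ^ (k + d - i) := by
    refine Finset.sum_bij' (fun i _ => d - i) (fun i _ => d - i) ?_ ?_ ?_ ?_ ?_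
    · intro i hi; simp only [mem_range, mem_Icc] at hi ⊢; omega
    · intro i hi; simp only [mem_range, mem_Icc] at hi ⊢; omega
    · intro i hi; simp only [mem_range] at hi; omega
    · intro i hi; simp only [mem_Icc] at hi; omega
    · intro i hi
      have hi := mem_range.1 hi
      rw [monicCoeff, dif_neg (by omega), if_neg (by omega),
        show k + d - (k + i) = d - i by omega, show k + d - (d - i) = k + i by omega]
  have h3 : monicCoeff k d a c (k + d) = 1 := by simp [monicCoeff]
  rw [linearizedMap_apply, sum_range_succ, sum_range_add, h1, h2, h3]
  ring

end Linearized

/-- For `f(x) = x^{q^{k+d}} - a₁ x^{q^{k+d-1}} + ⋯ + (-1)^d a_d x^{q^k} + (q-degree < k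
terms)`, one has `d_R(σ_f, G) = n - (k+d)` iff there are `k+d` linearly independent
elements `β_1, …, β_{k+d}` of `⟨g_1, …, g_n⟩` with
`a_i = det R_{k+d-i}(β) / det M_{k+d}(β)` for all `1 ≤ i ≤ d`. -/
theorem rank_dist_eq_iff_deg_k_add_d
    (q m n k d : ℕ) (hq : IsPrimePow q) (hm : 0 < m) (hn : 0 < n) (hnm : n ≤ m)
    (Fq F : Type) [Field Fq] [Fintype Fq] [Field F] [Fintype F] [Algebra Fq F]
    (hcardFq : Fintype.card Fq = q) (hcardF : Fintype.card F = q ^ m)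
    (g : Fin n → F) (hg : LinearIndependent Fq g)
    (hk : 1 ≤ k) (hd : 1 ≤ d) (hkdn : k + d < n)
    (a : ℕ → F) (c : Fin k → F)
    (σf : Fin n → F)
    (hσf : σf = fun j =>
      g j ^ q ^ (k + d) + (∑ i ∈ Finset.Icc 1 d, (-1 : F) ^ i * a i * g j ^ q ^ (k + d - i))
        + ∑ i : Fin k, c i * g j ^ q ^ (i : ℕ)) :
    rankDistTo Fq σf (gabidulinCode q g k) = n - (k + d) ↔
      ∃ β : Fin (k + d) → F, LinearIndependent Fq β ∧
        (∀ i, β i ∈ Submodule.span Fq (Set.range g)) ∧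
        ∀ i ∈ Finset.Icc 1 d,
          a i = (mooreMatrixDelRow q (k + d - i) β).det / (mooreMatrix q β).det := by
  subst hcardFq
  set V := Submodule.span Fq (Set.range g) with hV
  have hfd : FiniteDimensional Fq V :=
    FiniteDimensional.span_of_finite Fq (Set.finite_range g)
  let L (v : Fin k → F) : F →ₗ[Fq] F :=
    linearizedMap Fq (monicCoeff k d a (c - v)) (k + d + 1)
  have hmonic (v : Fin k → F) : monicCoeff k d a v (k + d) = 1 := by simp [monicCoeff]
  have hdiff (v : Fin k → F) :
      (σf - fun j => ∑ i : Fin k, v i * g j ^ Fintype.card Fq ^ (i : ℕ)) = L v ∘ g := by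
    funext j
    simp only [hσf, L, Pi.sub_apply, Function.comp_apply, linearizedMap_monicCoeff, sub_mul,
      Finset.sum_sub_distrib]
    ring
  have hrank (v : Fin k → F) := finrank_span_range_comp_add hg (L v)
  have hker (v : Fin k → F) :
      Module.finrank Fq (LinearMap.ker ((L v).domRestrict V)) ≤ k + d :=
    finrank_ker_linearizedMap_domRestrict_le (by simp [hmonic]) V
  have hroots (v : Fin k → F) :
      Module.finrank Fq (Submodule.span Fq (Set.range (L v ∘ g))) = n - (k + d) ↔
        ∃ β : Fin (k + d) → F, LinearIndependent Fq β ∧ (∀ i, β i ∈ V) ∧ ∀ i, L v (β i) = 0 := by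
    rw [← le_finrank_ker_domRestrict_iff (L v) V]
    have h1 := hrank v
    have h2 := hker v
    rw [← hV] at h1
    omega
  have hne : (gabidulinCode (Fintype.card Fq) g k).Nonempty :=
    ⟨fun j => ∑ i : Fin k, (0 : Fin k → F) i * g j ^ Fintype.card Fq ^ (i : ℕ), 0, rfl⟩
  rw [rankDistTo_eq_iff hne]
  · constructor
    · rintro ⟨_, ⟨v, rfl⟩, h⟩
      rw [hdiff, hroots] at h
      obtain ⟨β, hβ, hβV, h0⟩ := h
      refine ⟨β, hβ, hβV, fun i hi => ?_⟩
      have hi := Finset.mem_Icc.1 hi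
      have key := (linearizedMap_eq_zero_iff hβ (hmonic _)).1 h0 (k + d - i) (by omega)
      rw [monicCoeff, dif_neg (by omega), if_neg (by omega),
        show k + d - (k + d - i) = i by omega,
        show k + d - i + (k + d) = i + 2 * (k + d - i) by omega, pow_add, pow_mul] at key
      simpa using key
    · rintro ⟨β, hβ, hβV, h⟩
      let v : Fin k → F := fun i => c i - (-1) ^ ((i : ℕ) + (k + d)) *
        ((mooreMatrixDelRow (Fintype.card Fq) i β).det / (mooreMatrix (Fintype.card Fq) β).det)
      refine ⟨fun j => ∑ i : Fin k, v i * g j ^ Fintype.card Fq ^ (i : ℕ), ⟨v, rfl⟩, ?_⟩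
      rw [hdiff, hroots]
      refine ⟨β, hβ, hβV, (linearizedMap_eq_zero_iff hβ (hmonic _)).2 fun i hi => ?_⟩
      by_cases hik : i < k
      · simp [monicCoeff, hik, v]
      · rw [monicCoeff, dif_neg hik, if_neg (by omega),
          h (k + d - i) (Finset.mem_Icc.2 (by omega)),
          show k + d - (k + d - i) = i by omega,
          show i + (k + d) = (k + d - i) + 2 * i by omega, pow_add _ _ (2 * i), pow_mul]
        simp
  · rintro _ ⟨v, rfl⟩
    rw [hdiff]
    have h1 := hrank v
    have h2 := hker v
    rw [← hV] at h1
    omega
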